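/- The algebra Q^{U_n} of U_n-invariants in Q equals the ℂ-subalgebra ℂ[α, γ] generated by α and γ; moreover the monomials {α^a γ^b : a, b ∈ ℤ_{≥0}} form a ℂ-basis of Q^{U_n}, and for each m ≥ 0 the set {α^{m−a} γ^a : 0 ≤ a ≤ m} is a ℂ-basis of (Q_m)^{U_n}. -/

import Mathlib

open MvPolynomial

noncomputable section

/-- The polynomial ring `𝒫 = ℂ[x_{ij} : 1 ≤ i ≤ n, 1 ≤ j ≤ 2]` in the entries of an
`n × 2` matrix of indeterminates. -/
abbrev P (n : ℕ) : Type := MvPolynomial (Fin n × Fin 2) ℂ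

/-- The action of a matrix `g` on `𝒫`, given by `(g · f)(X) = f(gᵀ X)`;
on variables it sends `x_{ij} ↦ ∑ s g_{si} x_{sj}`. -/
def matAct (n : ℕ) (g : Matrix (Fin n) (Fin n) ℂ) : P n →ₐ[ℂ] P n :=
  aeval fun p : Fin n × Fin 2 => ∑ s : Fin n, C (g s p.1) * X (s, p.2)

/-- The action of `σ ∈ S₂` permuting columns: `x_{ij} ↦ x_{iσ(j)}`. -/
def permAct (n : ℕ) (σ : Equiv.Perm (Fin 2)) : P n →ₐ[ℂ] P n :=
  aeval fun p : Fin n × Fin 2 => X (p.1, σ p.2)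

/-- `g` is upper triangular with all diagonal entries equal to `1`, i.e. `g ∈ U_n`. -/
def IsUpperUni (n : ℕ) (g : Matrix (Fin n) (Fin n) ℂ) : Prop :=
  (∀ i, g i i = 1) ∧ ∀ i j, j < i → g i j = 0

/-- `f` is `U_n`-invariant. -/
def UInv (n : ℕ) (f : P n) : Prop :=
  ∀ g : Matrix (Fin n) (Fin n) ℂ, IsUpperUni n g → matAct n g f = f

/-- `f ∈ Q_m` : each monomial of `f` has total degree `m` in the column-`j` variables,
for each `j`. -/
def InQm (n m : ℕ) (f : P n) : Prop :=
  ∀ d ∈ f.support, ∀ j : Fin 2, (∑ i : Fin n, d (i, j)) = m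

/-- `f ∈ Q = ⊕ₘ Q_m` : each monomial of `f` has equal total degree in the two columns. -/
def InQ (n : ℕ) (f : P n) : Prop :=
  ∀ d ∈ f.support, ∀ j : Fin 2, (∑ i : Fin n, d (i, j)) = ∑ i : Fin n, d (i, (0 : Fin 2))

/-- The variable `x_{(i+1)(j+1)}`, `i j : Fin 2` (0-indexed rows and columns). -/
def Xe (n : ℕ) (hn : 2 ≤ n) (i j : Fin 2) : P n := X (Fin.castLE hn i, j)

/-- `α = x₁₁ x₁₂`. -/
def alpha (n : ℕ) (hn : 2 ≤ n) : P n := Xe n hn 0 0 * Xe n hn 0 1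

/-- `γ = x₁₁ x₂₂ − x₂₁ x₁₂`. -/
def gamma (n : ℕ) (hn : 2 ≤ n) : P n := Xe n hn 0 0 * Xe n hn 1 1 - Xe n hn 1 0 * Xe n hn 0 1

section UInvariantsQ

variable {n : ℕ}

lemma InQm.mul {a b : ℕ} {f g : P n} (hf : InQm n a f) (hg : InQm n b g) :
    InQm n (a + b) (f * g) := by
  classical
  intro d hd j
  obtain ⟨d₁, h₁, d₂, h₂, rfl⟩ := Finset.mem_add.1 (support_mul f g hd)
  simp [Finset.sum_add_distrib, hf d₁ h₁ j, hg d₂ h₂ j]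

lemma InQm.add {m : ℕ} {f g : P n} (hf : InQm n m f) (hg : InQm n m g) : InQm n m (f + g) := by
  classical
  intro d hd
  exact (Finset.mem_union.1 (support_add hd)).elim (hf d) (hg d)

lemma InQm.smul {m : ℕ} {f : P n} (c : ℂ) (hf : InQm n m f) : InQm n m (c • f) :=
  fun d hd => hf d (support_smul hd)

lemma InQm.one : InQm n 0 (1 : P n) := by
  intro d hd j
  have : d = 0 := by
    by_contra h
    exact mem_support_iff.1 hd (by rw [coeff_one, if_neg (Ne.symm h)])
  simp [this]

lemma InQm.pow {m : ℕ} {f : P n} (hf : InQm n m f) (k : ℕ) : InQm n (k * m) (f ^ k) := by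
  induction k with
  | zero => simpa using InQm.one
  | succ k ih => simpa [pow_succ, add_mul] using ih.mul hf

lemma InQm.inQ {m : ℕ} {f : P n} (hf : InQm n m f) : InQ n f :=
  fun d hd j => (hf d hd j).trans (hf d hd 0).symm

lemma InQ.mul {f g : P n} (hf : InQ n f) (hg : InQ n g) : InQ n (f * g) := by
  classical
  intro d hd j
  obtain ⟨d₁, h₁, d₂, h₂, rfl⟩ := Finset.mem_add.1 (support_mul f g hd)
  simp [Finset.sum_add_distrib, hf d₁ h₁ j, hg d₂ h₂ j]

lemma InQ.add {f g : P n} (hf : InQ n f) (hg : InQ n g) : InQ n (f + g) := by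
  classical
  intro d hd
  exact (Finset.mem_union.1 (support_add hd)).elim (hf d) (hg d)

lemma InQ.smul {f : P n} (c : ℂ) (hf : InQ n f) : InQ n (c • f) :=
  fun d hd => hf d (support_smul hd)

lemma inQm_X_mul_X (i k : Fin n) : InQm n 1 (X (i, 0) * X (k, 1) : P n) := by
  intro d hd j
  have hd' : d = Finsupp.single (i, 0) 1 + Finsupp.single (k, 1) 1 := by
    rw [X, X, monomial_mul] at hd
    simpa using support_monomial_subset hd
  subst hd'
  fin_cases j <;> simp [Finsupp.single_apply]

lemma inQm_alpha (hn : 2 ≤ n) : InQm n 1 (alpha n hn) := inQm_X_mul_X _ _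

lemma inQm_gamma (hn : 2 ≤ n) : InQm n 1 (gamma n hn) := by
  have := (inQm_X_mul_X (Fin.castLE hn 0) (Fin.castLE hn 1)).add
    ((inQm_X_mul_X (Fin.castLE hn 1) (Fin.castLE hn 0)).smul (-1))
  simpa [gamma, Xe, sub_eq_add_neg] using this

lemma matAct_Xe_zero (hn : 2 ≤ n) {g : Matrix (Fin n) (Fin n) ℂ} (hg : IsUpperUni n g)
    (j : Fin 2) : matAct n g (Xe n hn 0 j) = Xe n hn 0 j := by
  obtain ⟨k, rfl⟩ := Nat.exists_eq_add_of_le' hn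
  have h0 : Fin.castLE hn 0 = (0 : Fin (k + 2)) := rfl
  simp [matAct, Xe, h0, Fin.sum_univ_succ, hg.1, hg.2]

lemma matAct_Xe_one (hn : 2 ≤ n) {g : Matrix (Fin n) (Fin n) ℂ} (hg : IsUpperUni n g)
    (j : Fin 2) : matAct n g (Xe n hn 1 j) =
      Xe n hn 1 j + C (g (Fin.castLE hn 0) (Fin.castLE hn 1)) * Xe n hn 0 j := by
  obtain ⟨k, rfl⟩ := Nat.exists_eq_add_of_le' hn
  have h0 : Fin.castLE hn 0 = (0 : Fin (k + 2)) := rfl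
  have h1 : Fin.castLE hn 1 = (1 : Fin (k + 2)) := rfl
  have h2 : ∀ s : Fin k, g s.succ.succ 1 = 0 := fun s =>
    hg.2 _ _ (by simp [Fin.lt_def])
  simp [matAct, Xe, h0, h1, Fin.sum_univ_succ, hg.1, h2, add_comm]

lemma uInv_alpha (hn : 2 ≤ n) : UInv n (alpha n hn) := fun g hg => by
  simp [alpha, matAct_Xe_zero hn hg]

lemma uInv_gamma (hn : 2 ≤ n) : UInv n (gamma n hn) := fun g hg => by
  simp only [gamma, map_sub, map_mul, matAct_Xe_zero hn hg, matAct_Xe_one hn hg]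
  ring

/-- The invariants in `Q`, as a subalgebra of `𝒫`. -/
def invariantsQ (n : ℕ) : Subalgebra ℂ (P n) where
  carrier := {f | InQ n f ∧ UInv n f}
  mul_mem' hf hg := ⟨hf.1.mul hg.1, fun u hu => by rw [map_mul, hf.2 u hu, hg.2 u hu]⟩
  add_mem' hf hg := ⟨hf.1.add hg.1, fun u hu => by rw [map_add, hf.2 u hu, hg.2 u hu]⟩
  algebraMap_mem' c := by
    refine ⟨?_, fun u _ => AlgHom.commutes _ c⟩
    rw [Algebra.algebraMap_eq_smul_one]
    exact InQm.one.inQ.smul c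

/-- The invariants in `Q_m`, as a subspace of `𝒫`. -/
def invariantsQm (n m : ℕ) : Submodule ℂ (P n) where
  carrier := {f | InQm n m f ∧ UInv n f}
  add_mem' hf hg := ⟨hf.1.add hg.1, fun u hu => by rw [map_add, hf.2 u hu, hg.2 u hu]⟩
  zero_mem' := ⟨fun d hd => by simp at hd, fun u _ => map_zero _⟩
  smul_mem' c _ hf := ⟨hf.1.smul c, fun u hu => by rw [map_smul, hf.2 u hu]⟩

/-- The exponent only involves `x₁₁`, `x₁₂` and `x₂₂`. -/
def IsReducedExponent (hn : 2 ≤ n) (d : Fin n × Fin 2 →₀ ℕ) : Prop :=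
  ∀ p, p ≠ (Fin.castLE hn 0, 0) → p ≠ (Fin.castLE hn 0, 1) → p ≠ (Fin.castLE hn 1, 1) → d p = 0

lemma IsReducedExponent.sum_col_zero {hn : 2 ≤ n} {d : Fin n × Fin 2 →₀ ℕ}
    (hd : IsReducedExponent hn d) :
    ∑ i, d (i, 0) = d (Fin.castLE hn 0, 0) :=
  Finset.sum_eq_single _ (fun i _ hi => hd _ (by simpa using hi) (by simp) (by simp)) (by simp)

lemma IsReducedExponent.sum_col_one {hn : 2 ≤ n} {d : Fin n × Fin 2 →₀ ℕ}
    (hd : IsReducedExponent hn d) :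
    ∑ i, d (i, 1) = d (Fin.castLE hn 0, 1) + d (Fin.castLE hn 1, 1) :=
  Finset.sum_eq_add _ _ (by simp [Fin.ext_iff])
    (fun i _ hi => hd _ (by simp) (by simpa using hi.1) (by simpa using hi.2)) (by simp) (by simp)

lemma IsReducedExponent.prod_eq {hn : 2 ≤ n} {d : Fin n × Fin 2 →₀ ℕ}
    (hd : IsReducedExponent hn d)
    (Y : Fin n × Fin 2 → ℂ) :
    ∏ p, Y p ^ d p = Y (Fin.castLE hn 0, 0) ^ d (Fin.castLE hn 0, 0) *
      (Y (Fin.castLE hn 0, 1) ^ d (Fin.castLE hn 0, 1) *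
        Y (Fin.castLE hn 1, 1) ^ d (Fin.castLE hn 1, 1)) := by
  rw [Fintype.prod_prod_type_right, Fin.prod_univ_two]
  congr 1
  · exact Finset.prod_eq_single _
      (fun i _ hi => by rw [hd _ (by simpa using hi) (by simp) (by simp), pow_zero]) (by simp)
  · exact Finset.prod_eq_mul _ _ (by simp [Fin.ext_iff])
      (fun i _ hi => by rw [hd _ (by simp) (by simpa using hi.1) (by simpa using hi.2), pow_zero])
      (by simp) (by simp)

open Classical in
/-- The polynomial in `α` and `γ` read off from the monomials of `f` in `x₁₁`, `x₁₂`, `x₂₂`. -/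
def reduction (hn : 2 ≤ n) (f : P n) : P n :=
  ∑ d ∈ f.support with IsReducedExponent hn d,
    coeff d f • (alpha n hn ^ d (Fin.castLE hn 0, 1) * gamma n hn ^ d (Fin.castLE hn 1, 1))

lemma eval_matAct (g : Matrix (Fin n) (Fin n) ℂ) (f : P n) (x : Fin n × Fin 2 → ℂ) :
    eval x (matAct n g f) = eval (fun p => ∑ s, g s p.1 * x (s, p.2)) f := by
  induction f using MvPolynomial.induction_on with
  | C a => simp [matAct]
  | add p q hp hq => simp [hp, hq]
  | mul_X p i hp => rw [map_mul, map_mul, hp]; simp [matAct]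

/-- A generic matrix is brought by `U_n` to a matrix supported on the entries
`(1,1)`, `(1,2)`, `(2,2)`. -/
lemma exists_upperUni_reducing (hn : 2 ≤ n) (x : Fin n × Fin 2 → ℂ)
    (ha : x (Fin.castLE hn 0, 0) ≠ 0) (hγ : eval x (gamma n hn) ≠ 0) :
    ∃ g, IsUpperUni n g ∧ ∃ y : Fin n × Fin 2 → ℂ,
      (fun p : Fin n × Fin 2 => ∑ s, g s p.1 * x (s, p.2)) = y ∧
      y (Fin.castLE hn 0, 0) = x (Fin.castLE hn 0, 0) ∧
      y (Fin.castLE hn 0, 1) = x (Fin.castLE hn 0, 1) ∧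
      y (Fin.castLE hn 1, 1) = eval x (gamma n hn) / x (Fin.castLE hn 0, 0) ∧
      ∀ p, p ≠ (Fin.castLE hn 0, 0) → p ≠ (Fin.castLE hn 0, 1) → p ≠ (Fin.castLE hn 1, 1) →
        y p = 0 := by
  have hne : (Fin.castLE hn 1) ≠ Fin.castLE hn 0 := by simp [Fin.ext_iff]
  have h0le : ∀ i : Fin n, ¬ i < Fin.castLE hn 0 := by simp [Fin.lt_def]
  have h1lt : ∀ i : Fin n, i < Fin.castLE hn 1 → i = Fin.castLE hn 0 := by
    simp [Fin.lt_def, Fin.ext_iff]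
  generalize hG : eval x (gamma n hn) = G at *
  simp only [gamma, Xe, map_sub, map_mul, eval_X] at hG
  generalize Fin.castLE hn 0 = r at *
  generalize Fin.castLE hn 1 = s at *
  let u : Fin n → ℂ := fun i => if i = r then 0 else if i = s then -x (s, 0) / x (r, 0)
    else -(x (i, 0) * x (s, 1) - x (i, 1) * x (s, 0)) / G
  let v : Fin n → ℂ := fun i => if i = r then 0 else if i = s then 0
    else -(x (r, 0) * x (i, 1) - x (r, 1) * x (i, 0)) / G
  let g : Matrix (Fin n) (Fin n) ℂ := fun k i =>
    (if k = i then 1 else 0) + (if k = r then u i else 0) + if k = s then v i else 0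
  have key : ∀ i j, ∑ k, g k i * x (k, j) = x (i, j) + u i * x (r, j) + v i * x (s, j) := by
    intro i j
    simp [g, add_mul, Finset.sum_add_distrib]
  refine ⟨g, ⟨fun i => ?_, fun i j hij => ?_⟩, _, rfl, ?_, ?_, ?_, ?_⟩
  · have h1 : (if i = r then u i else 0) = 0 := by simp +contextual [u]
    have h2 : (if i = s then v i else 0) = 0 := by simp +contextual [v]
    simp only [g, h1, h2, if_true, add_zero]
  · have h1 : i ≠ r := fun h => h0le j (h ▸ hij)
    have h2 : i = s → v j = 0 := fun h => by simp [v, h1lt j (h ▸ hij)]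
    simp +contextual [g, h1, h2, hij.ne']
  · simp [key, u, v]
  · simp [key, u, v]
  · simp only [key, u, v, if_neg hne, if_true]
    field_simp
    rw [← hG]; ring
  · rintro ⟨i, j⟩ h1 h2 h3
    simp only [key]
    by_cases hir : i = r
    · subst hir
      fin_cases j <;> simp at h1 h2
    by_cases his : i = s
    · subst his
      fin_cases j
      · simp [u, v, hne]
        field_simp
        ring
      · simp at h3
    simp only [u, v, if_neg hir, if_neg his]
    field_simp
    fin_cases j <;> simp [← hG] <;> ring

lemma eval_reduction (hn : 2 ≤ n) {f : P n} (hQ : InQ n f) (hU : UInv n f)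
    (x : Fin n × Fin 2 → ℂ) (ha : x (Fin.castLE hn 0, 0) ≠ 0) (hγ : eval x (gamma n hn) ≠ 0) :
    eval x (reduction hn f) = eval x f := by
  classical
  obtain ⟨g, hg, y, hy, h00, h01, h11, hy0⟩ := exists_upperUni_reducing hn x ha hγ
  conv_rhs => rw [← hU g hg, eval_matAct, hy, eval_eq']
  rw [reduction, Finset.sum_filter, map_sum]
  refine Finset.sum_congr rfl fun d hd => ?_
  split_ifs with hr
  · have hdeg : d (Fin.castLE hn 0, 0) = d (Fin.castLE hn 0, 1) + d (Fin.castLE hn 1, 1) := by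
      rw [← hr.sum_col_zero, ← hr.sum_col_one, hQ d hd 1]
    rw [hr.prod_eq, h00, h01, h11, hdeg, smul_eval, map_mul, map_pow, map_pow]
    simp only [alpha, Xe, map_mul, eval_X, div_pow, pow_add, mul_pow]
    field_simp
  · simp only [IsReducedExponent, not_forall] at hr
    obtain ⟨p, h1, h2, h3, hp⟩ := hr
    rw [Finset.prod_eq_zero (Finset.mem_univ p) (by rw [hy0 p h1 h2 h3, zero_pow hp])]
    simp

/-- The algebra map `x₁₁ ↦ 1`, `x₁₂ ↦ X₀`, `x₂₂ ↦ X₁`, all other variables to `0`. -/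
def specialization (hn : 2 ≤ n) : P n →ₐ[ℂ] MvPolynomial (Fin 2) ℂ :=
  aeval fun p => if p = (Fin.castLE hn 0, 0) then 1 else if p = (Fin.castLE hn 0, 1) then X 0
    else if p = (Fin.castLE hn 1, 1) then X 1 else 0

lemma specialization_alpha (hn : 2 ≤ n) : specialization hn (alpha n hn) = X 0 := by
  simp [specialization, alpha, Xe]

lemma specialization_gamma (hn : 2 ≤ n) : specialization hn (gamma n hn) = X 1 := by
  simp [specialization, gamma, Xe, Fin.ext_iff]

lemma linearIndependent_alpha_gamma (hn : 2 ≤ n) :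
    LinearIndependent ℂ (fun p : ℕ × ℕ => alpha n hn ^ p.1 * gamma n hn ^ p.2) := by
  refine LinearIndependent.of_comp (specialization hn).toLinearMap ?_
  have hinj : Function.Injective
      (fun p : ℕ × ℕ => Finsupp.single (0 : Fin 2) p.1 + Finsupp.single 1 p.2) := by
    rintro ⟨a, b⟩ ⟨c, d⟩ h
    have h0 := DFunLike.congr_fun h 0
    have h1 := DFunLike.congr_fun h 1
    simp at h0 h1
    simp [h0, h1]
  have heq : (specialization hn).toLinearMap ∘
      (fun p : ℕ × ℕ => alpha n hn ^ p.1 * gamma n hn ^ p.2) =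
      basisMonomials (Fin 2) ℂ ∘
        fun p : ℕ × ℕ => Finsupp.single (0 : Fin 2) p.1 + Finsupp.single 1 p.2 := by
    ext1 p
    simp [specialization_alpha, specialization_gamma, X_pow_eq_monomial, monomial_mul]
  rw [heq]
  exact (basisMonomials (Fin 2) ℂ).linearIndependent.comp _ hinj

lemma gamma_ne_zero (hn : 2 ≤ n) : gamma n hn ≠ 0 := fun h => by
  have := specialization_gamma hn
  rw [h, map_zero] at this
  exact X_ne_zero _ this.symm

lemma reduction_eq (hn : 2 ≤ n) {f : P n} (hQ : InQ n f) (hU : UInv n f) :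
    reduction hn f = f := by
  have h : (X (Fin.castLE hn 0, 0) * gamma n hn) * (reduction hn f - f) = 0 := by
    refine MvPolynomial.funext fun x => ?_
    rw [map_zero, map_mul, map_mul, map_sub, eval_X]
    by_cases ha : x (Fin.castLE hn 0, 0) = 0
    · simp [ha]
    by_cases hγ : eval x (gamma n hn) = 0
    · simp [hγ]
    rw [eval_reduction hn hQ hU x ha hγ, sub_self, mul_zero]
  exact sub_eq_zero.1 ((mul_eq_zero.1 h).resolve_left
    (mul_ne_zero (X_ne_zero _) (gamma_ne_zero hn)))

lemma mem_span_of_inQ (hn : 2 ≤ n) {f : P n} (hQ : InQ n f) (hU : UInv n f) :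
    f ∈ Submodule.span ℂ
      (Set.range fun p : ℕ × ℕ => alpha n hn ^ p.1 * gamma n hn ^ p.2) := by
  rw [← reduction_eq hn hQ hU]
  exact Submodule.sum_mem _ fun d _ =>
    Submodule.smul_mem _ _ (Submodule.subset_span ⟨(_, _), rfl⟩)

lemma mem_span_of_inQm (hn : 2 ≤ n) {m : ℕ} {f : P n} (hQ : InQm n m f) (hU : UInv n f) :
    f ∈ Submodule.span ℂ (Set.range fun a : Fin (m + 1) =>
      alpha n hn ^ (m - (a : ℕ)) * gamma n hn ^ (a : ℕ)) := by
  classical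
  rw [← reduction_eq hn hQ.inQ hU]
  refine Submodule.sum_mem _ fun d hd => Submodule.smul_mem _ _ (Submodule.subset_span ?_)
  obtain ⟨hd, hr⟩ := Finset.mem_filter.1 hd
  have hm := hQ d hd 1
  rw [hr.sum_col_one] at hm
  exact ⟨⟨d (Fin.castLE hn 1, 1), by omega⟩, by simp [← hm]⟩

lemma adjoin_le_invariantsQ (hn : 2 ≤ n) :
    Algebra.adjoin ℂ {alpha n hn, gamma n hn} ≤ invariantsQ n := by
  refine Algebra.adjoin_le ?_
  rintro _ (rfl | rfl)
  exacts [⟨(inQm_alpha hn).inQ, uInv_alpha hn⟩, ⟨(inQm_gamma hn).inQ, uInv_gamma hn⟩]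

lemma span_le_adjoin (hn : 2 ≤ n) :
    Submodule.span ℂ (Set.range fun p : ℕ × ℕ => alpha n hn ^ p.1 * gamma n hn ^ p.2) ≤
      Subalgebra.toSubmodule (Algebra.adjoin ℂ {alpha n hn, gamma n hn}) := by
  rw [Submodule.span_le]
  rintro _ ⟨p, rfl⟩
  exact Subalgebra.mul_mem _ (pow_mem (Algebra.subset_adjoin (by simp)) _)
    (pow_mem (Algebra.subset_adjoin (by simp)) _)

lemma span_le_invariantsQm (hn : 2 ≤ n) (m : ℕ) :
    Submodule.span ℂ (Set.range fun a : Fin (m + 1) =>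
      alpha n hn ^ (m - (a : ℕ)) * gamma n hn ^ (a : ℕ)) ≤ invariantsQm n m := by
  rw [Submodule.span_le]
  rintro _ ⟨a, rfl⟩
  refine ⟨?_, fun u hu => ?_⟩
  · have := ((inQm_alpha hn).pow (m - a)).mul ((inQm_gamma hn).pow a)
    rwa [mul_one, mul_one, Nat.sub_add_cancel (Nat.le_of_lt_succ a.2)] at this
  · simp only [map_mul, map_pow, uInv_alpha hn u hu, uInv_gamma hn u hu]

end UInvariantsQ

/-- `Q^{U_n} = ℂ[α, γ]`; the monomials `α^a γ^b` form a ℂ-basis of `Q^{U_n}`; and for each `m`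
the set `{α^{m−a} γ^a : 0 ≤ a ≤ m}` is a ℂ-basis of `(Q_m)^{U_n}`. -/
theorem stmt_2 (n : ℕ) (hn : 2 ≤ n) :
    ({f : P n | InQ n f ∧ UInv n f} = (Algebra.adjoin ℂ {alpha n hn, gamma n hn} : Set (P n))) ∧
    LinearIndependent ℂ (fun p : ℕ × ℕ => alpha n hn ^ p.1 * gamma n hn ^ p.2) ∧
    ((Submodule.span ℂ
        (Set.range fun p : ℕ × ℕ => alpha n hn ^ p.1 * gamma n hn ^ p.2) : Set (P n)) =
      {f : P n | InQ n f ∧ UInv n f}) ∧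
    ∀ m : ℕ,
      LinearIndependent ℂ (fun a : Fin (m + 1) => alpha n hn ^ (m - (a : ℕ)) * gamma n hn ^ (a : ℕ)) ∧
      ((Submodule.span ℂ
          (Set.range fun a : Fin (m + 1) =>
            alpha n hn ^ (m - (a : ℕ)) * gamma n hn ^ (a : ℕ)) : Set (P n)) =
        {f : P n | InQm n m f ∧ UInv n f}) := by
  refine ⟨Set.Subset.antisymm ?_ (adjoin_le_invariantsQ hn), linearIndependent_alpha_gamma hn,
    Set.Subset.antisymm ?_ ?_, fun m => ⟨?_, Set.Subset.antisymm ?_ ?_⟩⟩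
  · exact fun f hf => span_le_adjoin hn (mem_span_of_inQ hn hf.1 hf.2)
  · exact fun f hf => adjoin_le_invariantsQ hn (span_le_adjoin hn hf)
  · exact fun f hf => mem_span_of_inQ hn hf.1 hf.2
  · exact (linearIndependent_alpha_gamma hn).comp (fun a : Fin (m + 1) => (m - (a : ℕ), (a : ℕ)))
      fun a b h => Fin.ext (Prod.ext_iff.1 h).2
  · exact span_le_invariantsQm hn m
  · exact fun f hf => mem_span_of_inQm hn hf.1 hf.2
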